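/- Let n, k, t be positive integers with n ≥ 12·k·t·ln(e²·t). Let F_1, …, F_t ⊆ C([n],k) satisfy |F_i| > C(n,k) − C(n−t+1,k) for every i ∈ [t]. Then {F_1, …, F_t} admits a rainbow matching. -/

import Mathlib

open Finset

/-- The number of elements of `A` that are smaller than `p`. -/
def countBelow (A : Finset ℕ) (p : ℕ) : ℕ := #{x ∈ A | x < p}

/-- A family is shifted if replacing an element of a member by a smaller one stays in it. -/
def IsShifted (𝒜 : Finset (Finset ℕ)) : Prop :=
  ∀ A ∈ 𝒜, ∀ a b, a < b → b ∈ A → a ∉ A → insert a (A.erase b) ∈ 𝒜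

/-- The family `F` has a rainbow matching. -/
def HasRainbowMatching {ι : Type*} (F : ι → Finset (Finset ℕ)) : Prop :=
  ∃ e : ι → Finset ℕ, (∀ i, e i ∈ F i) ∧ ∀ i j, i ≠ j → Disjoint (e i) (e j)

lemma countBelow_mono_right (A : Finset ℕ) {p q : ℕ} (h : p ≤ q) :
    countBelow A p ≤ countBelow A q :=
  card_le_card fun x hx ↦ by simp only [mem_filter] at hx ⊢; exact ⟨hx.1, by omega⟩

lemma countBelow_succ (A : Finset ℕ) (p : ℕ) :
    countBelow A (p + 1) = countBelow A p + if p ∈ A then 1 else 0 := by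
  unfold countBelow
  split_ifs with h
  · have : {x ∈ A | x < p + 1} = insert p {x ∈ A | x < p} := by
      ext x; simp only [mem_filter, mem_insert]; grind
    rw [this, card_insert_of_notMem (by simp)]
  · congr 1; ext x; simp only [mem_filter]; grind

lemma countBelow_le_card (A : Finset ℕ) (p : ℕ) : countBelow A p ≤ #A := card_filter_le _ _

lemma countBelow_insert_le (A : Finset ℕ) (a p : ℕ) :
    countBelow (insert a A) p ≤ countBelow A p + if a < p then 1 else 0 := by
  unfold countBelow
  rw [filter_insert]
  split_ifs
  · exact card_insert_le _ _
  · simp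

lemma countBelow_eq_zero {A : Finset ℕ} {p : ℕ} (h : ∀ x ∈ A, p ≤ x) : countBelow A p = 0 := by
  simp only [countBelow, card_eq_zero, filter_eq_empty_iff]
  intro x hx; have := h x hx; omega

lemma countBelow_add_eq {A : Finset ℕ} {T : ℕ} (h : ∀ x ∈ A, T ≤ x) (p : ℕ) :
    countBelow A (T + p) = #(A ∩ Ico T (T + p)) := by
  unfold countBelow
  congr 1; ext x
  simp only [mem_filter, mem_inter, mem_Ico]
  grind

lemma countBelow_add_le {A : Finset ℕ} {T : ℕ} (h : ∀ x ∈ A, T ≤ x) (p : ℕ) :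
    countBelow A (T + p) ≤ p := by
  rw [countBelow_add_eq h]
  exact (card_le_card inter_subset_right).trans (by simp)

lemma countBelow_replace_add_le {A : Finset ℕ} {a b : ℕ} (hb : b ∈ A) (p : ℕ) :
    countBelow (insert a (A.erase b)) p + (if b < p then 1 else 0)
      ≤ countBelow A p + if a < p then 1 else 0 := by
  have h1 := countBelow_insert_le (A.erase b) a p
  have h2 : countBelow (A.erase b) p + (if b < p then 1 else 0) = countBelow A p := by
    unfold countBelow
    rw [filter_erase]
    split_ifs with h
    · exact card_erase_add_one (by simp [hb, h])
    · rw [erase_eq_of_notMem (by simp [h])]; simp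
  omega

lemma sum_replace_lt {A : Finset ℕ} {a b : ℕ} (hab : a < b) (hb : b ∈ A) :
    ∑ x ∈ insert a (A.erase b), x < ∑ x ∈ A, x := by
  have h1 : ∑ x ∈ insert a (A.erase b), x ≤ a + ∑ x ∈ A.erase b, x := by
    by_cases h : a ∈ A.erase b
    · rw [insert_eq_of_mem h]; omega
    · rw [sum_insert h]
  have h2 := sum_erase_add A (fun x ↦ x) hb
  omega

/-- In shifted families, members whose total counts on initial segments are at most the lengths of
these segments can be moved down to pairwise disjoint members. -/
theorem hasRainbowMatching_of_sum_countBelow_le {ι : Type*} [Fintype ι] [DecidableEq ι]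
    {F : ι → Finset (Finset ℕ)} (hF : ∀ i, IsShifted (F i)) (e : ι → Finset ℕ)
    (he : ∀ i, e i ∈ F i) (hc : ∀ l, ∑ i, countBelow (e i) l ≤ l) : HasRainbowMatching F := by
  induction hw : ∑ i, ∑ x ∈ e i, x using Nat.strong_induction_on generalizing e with
  | _ w ih =>
  subst hw
  by_cases hdis : ∀ i j, i ≠ j → Disjoint (e i) (e j)
  · exact ⟨e, he, hdis⟩
  push Not at hdis
  obtain ⟨i, j, hij, hd⟩ := hdis
  obtain ⟨b, hbi, hbj⟩ := not_disjoint_iff.mp hd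
  have hsucc (l : ℕ) : ∑ s, countBelow (e s) (l + 1)
      = ∑ s, countBelow (e s) l + #{s | l ∈ e s} := by
    simp_rw [countBelow_succ, sum_add_distrib, card_filter]
  have hslack (d : ℕ) : ∀ l, l + d = b → (∀ x, l ≤ x → x < b → ∃ s, x ∈ e s) →
      ∑ s, countBelow (e s) l + 1 ≤ l := by
    induction d with
    | zero =>
      rintro l hl -
      have h1 := hsucc l
      have h2 := hc (l + 1)
      have h3 : 2 ≤ #{s | l ∈ e s} := by
        rw [← card_pair hij]
        apply card_le_card
        intro s hs
        simp only [mem_insert, mem_singleton] at hs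
        obtain rfl : l = b := by omega
        rcases hs with rfl | rfl <;> simpa
      omega
    | succ d ihd =>
      intro l hl hcov
      have h1 := hsucc l
      have h2 := ihd (l + 1) (by omega) fun x hx hxb ↦ hcov x (by omega) hxb
      obtain ⟨s, hs⟩ := hcov l le_rfl (by omega)
      have h3 : 0 < #{s | l ∈ e s} := card_pos.mpr ⟨s, by simpa⟩
      omega
  have hmiss : ({x ∈ range b | ∀ s, x ∉ e s} : Finset ℕ).Nonempty := by
    by_contra h
    rw [not_nonempty_iff_eq_empty, filter_eq_empty_iff] at h
    have := hslack b 0 (by omega) fun x _ hx ↦ by simpa using h (mem_range.mpr hx)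
    omega
  obtain ⟨a, ha, hamax⟩ := exists_max_image _ id hmiss
  simp only [mem_filter, mem_range, id] at ha hamax
  obtain ⟨hab, hae⟩ := ha
  have hcov (x : ℕ) (hx : a < x) (hxb : x < b) : ∃ s, x ∈ e s := by
    by_contra! h
    have := hamax x ⟨hxb, h⟩
    omega
  refine ih _ ?_ (Function.update e i (insert a ((e i).erase b))) ?_ ?_ rfl
  · refine sum_lt_sum (fun s _ ↦ ?_) ⟨i, mem_univ i, ?_⟩
    · by_cases hs : s = i
      · subst hs; simpa using (sum_replace_lt hab hbi).le
      · simp [hs]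
    · simpa using sum_replace_lt hab hbi
  · intro s
    by_cases hs : s = i
    · subst hs; simpa using hF s _ (he s) a b hab hbi (hae s)
    · simpa [hs] using he s
  · intro l
    have h1 := countBelow_replace_add_le (a := a) hbi l
    have h2 : ∑ s, countBelow (Function.update e i (insert a ((e i).erase b)) s) l
        + countBelow (e i) l
        = ∑ s, countBelow (e s) l + countBelow (insert a ((e i).erase b)) l := by
      rw [← add_sum_erase _ _ (mem_univ i), ← add_sum_erase univ (fun s ↦ countBelow (e s) l)
        (mem_univ i)]
      have : ∑ s ∈ univ.erase i, countBelow (Function.update e i (insert a ((e i).erase b)) s) l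
          = ∑ s ∈ univ.erase i, countBelow (e s) l :=
        sum_congr rfl fun s hs ↦ by simp [(mem_erase.mp hs).1]
      rw [this]; simp; ring
    have h3 := hc l
    by_cases hl : a < l ∧ l ≤ b
    · have := hslack (b - l) l (by omega) fun x hx hxb ↦ hcov x (by omega) hxb
      split_ifs at h1 <;> omega
    · split_ifs at h1 <;> omega

/-- The effect on `A` of the shift of the family `𝒜` which replaces `b` by `a`. -/
def shiftMember (a b : ℕ) (𝒜 : Finset (Finset ℕ)) (A : Finset ℕ) : Finset ℕ :=
  if b ∈ A ∧ a ∉ A ∧ insert a (A.erase b) ∉ 𝒜 then insert a (A.erase b) else A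

lemma shiftMember_injOn (a b : ℕ) (𝒜 : Finset (Finset ℕ)) :
    Set.InjOn (shiftMember a b 𝒜) 𝒜 := by
  intro A hA B hB h
  simp only [mem_coe] at hA hB
  unfold shiftMember at h
  split_ifs at h with h1 h2 h2
  · ext x
    have := congrArg (x ∈ ·) h
    simp only [mem_insert, mem_erase, eq_iff_iff] at this
    grind
  · exact absurd (h ▸ hB) h1.2.2
  · exact absurd (h ▸ hA) h2.2.2
  · exact h

lemma mem_of_mem_image_shiftMember {a b : ℕ} {𝒜 : Finset (Finset ℕ)} {A : Finset ℕ}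
    (h : A ∈ 𝒜.image (shiftMember a b 𝒜)) (hA : a ∉ A ∨ b ∈ A) (hab : a ≠ b) : A ∈ 𝒜 := by
  obtain ⟨B, hB, rfl⟩ := mem_image.mp h
  unfold shiftMember at hA ⊢
  split_ifs with h1
  · rw [if_pos h1] at hA
    simp [hab.symm] at hA
  · exact hB

lemma replace_mem_of_mem_image_shiftMember {a b : ℕ} {𝒜 : Finset (Finset ℕ)} {A : Finset ℕ}
    (h : A ∈ 𝒜.image (shiftMember a b 𝒜)) (ha : a ∉ A) (hb : b ∈ A) :
    insert a (A.erase b) ∈ 𝒜 := by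
  obtain ⟨B, hB, rfl⟩ := mem_image.mp h
  unfold shiftMember at ha hb ⊢
  split_ifs at ha hb ⊢ with h1
  · simp at ha
  · by_contra h2; exact h1 ⟨hb, ha, h2⟩

lemma replace_back_mem_of_mem_image_shiftMember {a b : ℕ} {𝒜 : Finset (Finset ℕ)} {A : Finset ℕ}
    (h : A ∈ 𝒜.image (shiftMember a b 𝒜)) (hA : A ∉ 𝒜) :
    insert b (A.erase a) ∈ 𝒜 := by
  obtain ⟨B, hB, rfl⟩ := mem_image.mp h
  unfold shiftMember at hA ⊢
  split_ifs at hA ⊢ with h1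
  · convert hB using 1
    ext x; simp only [mem_insert, mem_erase]; grind
  · exact absurd hB hA

lemma HasRainbowMatching.of_shift {ι : Type*} {F : ι → Finset (Finset ℕ)} {a b : ℕ} (hab : a < b)
    (h : HasRainbowMatching fun i ↦ (F i).image (shiftMember a b (F i))) :
    HasRainbowMatching F := by
  classical
  obtain ⟨e, he, hd⟩ := h
  by_cases hall : ∀ i, e i ∈ F i
  · exact ⟨e, hall, hd⟩
  push Not at hall
  obtain ⟨i, hi⟩ := hall
  have hai : a ∈ e i ∧ b ∉ e i := by
    by_contra h
    exact hi (mem_of_mem_image_shiftMember (he i) (by tauto) hab.ne)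
  have ha (j : ι) (hj : j ≠ i) : a ∉ e j := fun h ↦ disjoint_left.mp (hd j i hj) h hai.1
  refine ⟨fun j ↦ if j = i then insert b ((e i).erase a) else
    if b ∈ e j then insert a ((e j).erase b) else e j, fun j ↦ ?_, fun j l hjl ↦ ?_⟩
  · dsimp only
    split_ifs with h1 h2
    · subst h1; exact replace_back_mem_of_mem_image_shiftMember (he j) hi
    · exact replace_mem_of_mem_image_shiftMember (he j) (ha j h1) h2
    · exact mem_of_mem_image_shiftMember (he j) (.inl (ha j h1)) hab.ne
  · have hjl' : ∀ x ∈ e j, x ∉ e l := fun x hx ↦ disjoint_left.mp (hd j l hjl) hx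
    have haj := ha j
    have hal := ha l
    rw [disjoint_left]
    intro x hx hx'
    have := hjl' x
    have := hjl' b
    have := hab.ne
    dsimp only at hx hx'
    split_ifs at hx hx' <;> grind

/-- To find rainbow matchings one may assume that all the families are shifted. -/
theorem hasRainbowMatching_of_forall_isShifted {ι : Type*} [Fintype ι] {n k : ℕ} {c : ι → ℕ}
    (hshift : ∀ F : ι → Finset (Finset ℕ), (∀ i, F i ⊆ (range n).powersetCard k) →
      (∀ i, #(F i) = c i) → (∀ i, IsShifted (F i)) → HasRainbowMatching F)
    (F : ι → Finset (Finset ℕ)) (hF : ∀ i, F i ⊆ (range n).powersetCard k)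
    (hc : ∀ i, #(F i) = c i) : HasRainbowMatching F := by
  induction hw : ∑ i, ∑ A ∈ F i, ∑ x ∈ A, x using Nat.strong_induction_on generalizing F with
  | _ w ih =>
  subst hw
  by_cases hs : ∀ i, IsShifted (F i)
  · exact hshift F hF hc hs
  simp only [IsShifted] at hs
  push Not at hs
  obtain ⟨i, A, hA, a, b, hab, hbA, haA, hnot⟩ := hs
  have hle (j : ι) (B : Finset ℕ) : ∑ x ∈ shiftMember a b (F j) B, x ≤ ∑ x ∈ B, x := by
    unfold shiftMember
    split_ifs with h
    · exact (sum_replace_lt hab h.1).le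
    · exact le_rfl
  refine HasRainbowMatching.of_shift hab (ih _ ?_ _ (fun j ↦ ?_) (fun j ↦ ?_) rfl)
  · simp_rw [sum_image (shiftMember_injOn a b _)]
    refine sum_lt_sum (fun j _ ↦ sum_le_sum fun B _ ↦ hle j B) ⟨i, mem_univ i, ?_⟩
    refine sum_lt_sum (fun B _ ↦ hle i B) ⟨A, hA, ?_⟩
    rw [shiftMember, if_pos ⟨hbA, haA, hnot⟩]
    exact sum_replace_lt hab hbA
  · intro B hB
    obtain ⟨C, hC, rfl⟩ := mem_image.mp hB
    have hC' := hF j hC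
    unfold shiftMember
    split_ifs with h
    · rw [mem_powersetCard] at hC' ⊢
      refine ⟨fun x hx ↦ ?_, ?_⟩
      · have hb := hC'.1 h.1
        have := @hC'.1 x
        simp only [mem_insert, mem_erase, mem_range] at *
        rcases hx with rfl | hx
        · omega
        · exact this hx.2
      · rw [card_insert_of_notMem (by simp [h.2.1]), card_erase_add_one h.1, hC'.2]
    · exact hC'
  · rw [card_image_of_injOn (shiftMember_injOn a b _), hc]

lemma choose_sub_sub_mul_pow_le {N m : ℕ} (hm : m ≤ N) {q : ℕ} (hq : q ≤ m) :
    (N - q).choose (m - q) * N ^ q ≤ m ^ q * N.choose m := by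
  induction q with
  | zero => simp
  | succ q ih =>
    have ih := ih (by omega)
    obtain ⟨d, rfl⟩ := Nat.exists_eq_add_of_le hq
    obtain ⟨c, rfl⟩ := Nat.exists_eq_add_of_le hm
    have e1 : q + 1 + d + c - (q + 1) = d + c := by omega
    have e2 : q + 1 + d - (q + 1) = d := by omega
    have e3 : q + 1 + d + c - q = d + c + 1 := by omega
    have e4 : q + 1 + d - q = d + 1 := by omega
    rw [e3, e4] at ih
    rw [e1, e2]
    have hs := Nat.add_one_mul_choose_eq (d + c) d
    set N := q + 1 + d + c
    set m := q + 1 + d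
    refine Nat.le_of_mul_le_mul_left ?_ (show 0 < d + c + 1 by omega)
    calc (d + c + 1) * ((d + c).choose d * N ^ (q + 1))
        = ((d + 1) * N) * ((d + c + 1).choose (d + 1) * N ^ q) := by
          rw [← mul_assoc, hs]; ring
      _ ≤ (m * (d + c + 1)) * (m ^ q * N.choose m) := by
          refine Nat.mul_le_mul ?_ ih
          simp only [N, m]; nlinarith
      _ = _ := by ring

lemma card_filter_le_card_inter_le (W Z : Finset ℕ) (m q : ℕ) :
    (#{A ∈ W.powersetCard m | q ≤ #(A ∩ Z)} : ℝ)
      ≤ (#Z).choose q * ((m : ℝ) / #W) ^ q * (#W).choose m := by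
  by_cases hq : q ≤ m
  swap
  · have : {A ∈ W.powersetCard m | q ≤ #(A ∩ Z)} = ∅ := by
      rw [filter_eq_empty_iff]
      intro A hA h
      have := (mem_powersetCard.mp hA).2
      have := card_le_card (inter_subset_left : A ∩ Z ⊆ A)
      omega
    rw [this, card_empty, Nat.cast_zero]; positivity
  by_cases hm : m ≤ #W
  swap
  · rw [powersetCard_eq_empty.mpr (by omega)]; simp; positivity
  have hcount : #{A ∈ W.powersetCard m | q ≤ #(A ∩ Z)}
      ≤ (#Z).choose q * (#W - q).choose (m - q) := by
    have hsub : {A ∈ W.powersetCard m | q ≤ #(A ∩ Z)} ⊆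
        ((Z ∩ W).powersetCard q).biUnion fun Q ↦ {A ∈ W.powersetCard m | Q ⊆ A} := by
      intro A hA
      simp only [mem_filter, mem_powersetCard, mem_biUnion] at hA ⊢
      obtain ⟨Q, hQ, hQc⟩ := exists_subset_card_eq hA.2
      refine ⟨Q, ⟨fun x hx ↦ ?_, hQc⟩, hA.1, hQ.trans inter_subset_left⟩
      have := mem_inter.mp (hQ hx)
      exact mem_inter.mpr ⟨this.2, hA.1.1 this.1⟩
    refine (card_le_card hsub).trans ((card_biUnion_le_card_mul _ _
      ((#W - q).choose (m - q)) fun Q hQ ↦ ?_).trans (Nat.mul_le_mul_right _ ?_))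
    · rw [mem_powersetCard] at hQ
      have hQW : Q ⊆ W := hQ.1.trans inter_subset_right
      rw [← hQ.2, ← card_sdiff_of_subset hQW, ← card_powersetCard]
      refine card_le_card_of_injOn (· \ Q) (fun A hA ↦ ?_) fun A hA B hB h ↦ ?_
      · simp only [coe_filter, Set.mem_ofPred_eq, mem_powersetCard, mem_coe] at hA ⊢
        exact ⟨sdiff_subset_sdiff hA.1.1 le_rfl, by rw [card_sdiff_of_subset hA.2, hA.1.2]⟩
      · simp only [coe_filter, Set.mem_ofPred_eq] at hA hB h
        rw [← sdiff_union_of_subset hA.2, h, sdiff_union_of_subset hB.2]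
    · rw [card_powersetCard]
      exact Nat.choose_le_choose q (card_le_card inter_subset_left)
  rcases Nat.eq_zero_or_pos (#W) with h0 | hpos
  · obtain rfl : m = 0 := by omega
    obtain rfl : q = 0 := by omega
    simp
  have hN : (0 : ℝ) < #W := by exact_mod_cast hpos
  have h1 : ((#W - q).choose (m - q) : ℝ) ≤ ((m : ℝ) / #W) ^ q * (#W).choose m := by
    rw [div_pow, div_mul_eq_mul_div, le_div_iff₀ (by positivity)]
    exact_mod_cast choose_sub_sub_mul_pow_le hm hq
  calc (#{A ∈ W.powersetCard m | q ≤ #(A ∩ Z)} : ℝ)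
      ≤ (#Z).choose q * (#W - q).choose (m - q) := by exact_mod_cast hcount
    _ ≤ (#Z).choose q * (((m : ℝ) / #W) ^ q * (#W).choose m) := by gcongr
    _ = _ := by ring

lemma pow_self_le_three_pow_mul_factorial (q : ℕ) :
    ((q + 1 : ℕ) : ℝ) ^ (q + 1) ≤ 3 ^ q * (q + 1).factorial := by
  induction q with
  | zero => simp
  | succ q ih =>
    have h1 : (1 + 1 / ((q : ℝ) + 1)) ^ (q + 1) ≤ 3 := by
      calc (1 + 1 / ((q : ℝ) + 1)) ^ (q + 1) ≤ Real.exp (1 / ((q : ℝ) + 1)) ^ (q + 1) := by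
            gcongr
            rw [add_comm]; exact Real.add_one_le_exp _
        _ = Real.exp 1 := by
            rw [← Real.exp_nat_mul]; congr 1; push_cast; field_simp
        _ ≤ 3 := Real.exp_one_lt_three.le
    have h2 : ((q + 1 + 1 : ℕ) : ℝ) = (1 + 1 / ((q : ℝ) + 1)) * (q + 1 : ℕ) := by
      push_cast; field_simp
    calc ((q + 1 + 1 : ℕ) : ℝ) ^ (q + 1 + 1)
        = (q + 1 + 1 : ℕ) * ((1 + 1 / ((q : ℝ) + 1)) ^ (q + 1) * ((q + 1 : ℕ) : ℝ) ^ (q + 1)) := by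
          rw [pow_succ' ((q + 1 + 1 : ℕ) : ℝ) (q + 1), ← mul_pow, ← h2]
      _ ≤ (q + 1 + 1 : ℕ) * (3 * (3 ^ q * (q + 1).factorial)) := by gcongr
      _ = _ := by rw [Nat.factorial_succ (q + 1)]; push_cast; ring

lemma choose_mul_succ_le (c q : ℕ) :
    ((c * (q + 1)).choose (q + 1) : ℝ) ≤ c ^ (q + 1) * 3 ^ q := by
  refine (Nat.choose_le_pow_div _ _).trans ?_
  rw [div_le_iff₀ (by positivity)]
  push_cast
  rw [mul_pow, mul_assoc]
  gcongr
  exact_mod_cast pow_self_le_three_pow_mul_factorial q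

lemma choose_mul_succ_le' (c q : ℕ) :
    ((c * (q + 1)).choose (q + 2) : ℝ) ≤ c ^ (q + 2) * 3 ^ q := by
  refine (Nat.choose_le_pow_div _ _).trans ?_
  rw [div_le_iff₀ (by positivity)]
  have h := pow_self_le_three_pow_mul_factorial q
  push_cast
  rw [mul_pow, mul_assoc]
  gcongr
  rw [Nat.factorial_succ (q + 1), pow_succ]
  push_cast at h ⊢
  calc ((q : ℝ) + 1) ^ (q + 1) * (q + 1) ≤ (3 ^ q * (q + 1).factorial) * (q + 1 + 1) := by
        gcongr; linarith
    _ = _ := by ring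

lemma pow_mul_choose_le_choose_sub (N m z : ℕ) (h : 20 * m + z ≤ N) :
    ((19 : ℝ) / 20) ^ z * N.choose m ≤ (N - z).choose m := by
  induction z with
  | zero => simp
  | succ z ih =>
    have ih := ih (by omega)
    obtain ⟨d, hd⟩ : ∃ d, N - z = d + 1 := ⟨N - z - 1, by omega⟩
    rw [hd] at ih
    have hd' : N - (z + 1) = d := by omega
    rw [hd']
    have h1 : ((d + 1).choose m : ℝ) * (d + 1 - m) = d.choose m * (d + 1) := by
      have := Nat.choose_mul_succ_eq d m
      rw [← Nat.cast_inj (R := ℝ)] at this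
      rw [Nat.cast_mul, Nat.cast_mul, Nat.cast_sub (by omega)] at this
      push_cast at this
      linarith
    have h2 : (20 * m : ℝ) ≤ d + 1 := by exact_mod_cast (by omega : 20 * m ≤ d + 1)
    have h3 : (19 / 20 : ℝ) * (d + 1).choose m ≤ d.choose m := by
      refine le_of_mul_le_mul_right ?_ (show (0 : ℝ) < d + 1 by positivity)
      rw [← h1]
      have : (0 : ℝ) ≤ (d + 1).choose m := by positivity
      nlinarith
    rw [pow_succ']
    linarith

/-- The `m`-subsets of `W` with at most `p / c` elements below `T + p`, for every `p`. -/
noncomputable def sparseSets (T c m : ℕ) (W : Finset ℕ) : Finset (Finset ℕ) :=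
  open Classical in {A ∈ W.powersetCard m | ∀ p, c * countBelow A (T + p) ≤ p}

/-- The `k`-subsets of `[T, n)` which have, for some `q ≥ b`, at least `q` elements among the first
`c * (q - 1)` elements of `[T, n)`. -/
noncomputable def crowdedSets (T n c b k : ℕ) : Finset (Finset ℕ) :=
  open Classical in
  {A ∈ (Ico T n).powersetCard k | ∃ q, b ≤ q ∧ q ≤ countBelow A (T + c * (q - 1))}

lemma mem_sparseSets {T c m : ℕ} {W A : Finset ℕ} :
    A ∈ sparseSets T c m W ↔ A ∈ W.powersetCard m ∧ ∀ p, c * countBelow A (T + p) ≤ p := by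
  classical exact mem_filter

lemma mem_crowdedSets {T n c b k : ℕ} {A : Finset ℕ} :
    A ∈ crowdedSets T n c b k ↔ A ∈ (Ico T n).powersetCard k ∧
      ∃ q, b ≤ q ∧ q ≤ countBelow A (T + c * (q - 1)) := by
  classical exact mem_filter

lemma le_of_mem_powersetCard_Ico {T n k : ℕ} {A : Finset ℕ} (hA : A ∈ (Ico T n).powersetCard k) :
    ∀ x ∈ A, T ≤ x :=
  fun _ hx ↦ (mem_Ico.mp ((mem_powersetCard.mp hA).1 hx)).1

lemma card_sparseSets_ge {T t m : ℕ} {W : Finset ℕ} (hW : ∀ x ∈ W, T ≤ x) (ht : 0 < t)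
    (hcard : 22 * (m + 1) * t ≤ #W) :
    7 / 8 * ((#W).choose m : ℝ) ≤ #(sparseSets T (2 * t) m W) := by
  classical
  have hWpos : (0 : ℝ) < #W := by
    have : 0 < 22 * (m + 1) * t := by positivity
    exact_mod_cast this.trans_le hcard
  set x : ℝ := (m : ℝ) / #W with hx
  have hx0 : 0 ≤ x := by positivity
  have htx : 6 * t * x ≤ 3 / 11 := by
    have : (22 * (m + 1) * t : ℝ) ≤ #W := by exact_mod_cast hcard
    have ht' : (0 : ℝ) < t := by exact_mod_cast ht
    rw [hx, mul_div_assoc', div_le_iff₀ hWpos]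
    nlinarith
  have hcover : W.powersetCard m ⊆ sparseSets T (2 * t) m W ∪
      (range m).biUnion fun q ↦
        {A ∈ W.powersetCard m | q + 1 ≤ #(A ∩ Ico T (T + 2 * t * (q + 1)))} := by
    intro A hA
    by_cases h : ∀ p, 2 * t * countBelow A (T + p) ≤ p
    · exact mem_union_left _ (mem_sparseSets.mpr ⟨hA, h⟩)
    push Not at h
    obtain ⟨p, hp⟩ := h
    refine mem_union_right _ (mem_biUnion.mpr ⟨countBelow A (T + p) - 1, ?_, ?_⟩)
    · have h1 := countBelow_le_card A (T + p)
      have h2 := (mem_powersetCard.mp hA).2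
      have h3 : countBelow A (T + p) ≠ 0 := fun h0 ↦ by simp [h0] at hp
      rw [mem_range]; omega
    · have h3 : countBelow A (T + p) ≠ 0 := fun h0 ↦ by simp [h0] at hp
      have h4 : countBelow A (T + p) - 1 + 1 = countBelow A (T + p) := by omega
      have hAT : ∀ x ∈ A, T ≤ x := fun x hx ↦ hW x ((mem_powersetCard.mp hA).1 hx)
      rw [mem_filter, h4, ← countBelow_add_eq hAT]
      exact ⟨hA, countBelow_mono_right A (by omega)⟩
  have hterm (q : ℕ) : (#{A ∈ W.powersetCard m | q + 1 ≤ #(A ∩ Ico T (T + 2 * t * (q + 1)))} : ℝ)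
      ≤ 1 / 3 * (6 * t * x) ^ (q + 1) * (#W).choose m := by
    refine (card_filter_le_card_inter_le W _ m (q + 1)).trans ?_
    rw [← hx, Nat.card_Ico, Nat.add_sub_cancel_left]
    gcongr ?_ * _
    calc ((2 * t * (q + 1)).choose (q + 1) : ℝ) * x ^ (q + 1)
        ≤ (((2 * t : ℕ) : ℝ) ^ (q + 1) * 3 ^ q) * x ^ (q + 1) := by
          gcongr; exact choose_mul_succ_le (2 * t) q
      _ = _ := by
          rw [show (6 * t * x : ℝ) = (2 * t : ℕ) * 3 * x by push_cast; ring, mul_pow, mul_pow,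
            pow_succ (3 : ℝ)]
          ring
  have hgeom : ∑ q ∈ range m, (6 * t * x : ℝ) ^ (q + 1) ≤ 3 / 8 := by
    have h1 := geom_sum_Ico_le_of_lt_one (m := 1) (n := m + 1) (x := (6 * t * x : ℝ))
      (by positivity) (by linarith)
    rw [sum_Ico_eq_sum_range] at h1
    simp only [Nat.add_sub_cancel, pow_one, add_comm 1] at h1
    refine h1.trans ?_
    rw [div_le_iff₀ (by linarith)]
    linarith
  have hsum : ((#W).choose m : ℝ) ≤ #(sparseSets T (2 * t) m W) +
      ∑ q ∈ range m, 1 / 3 * (6 * t * x) ^ (q + 1) * (#W).choose m := by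
    calc ((#W).choose m : ℝ) = #(W.powersetCard m) := by rw [card_powersetCard]
      _ ≤ #(sparseSets T (2 * t) m W) + ∑ q ∈ range m,
          (#{A ∈ W.powersetCard m | q + 1 ≤ #(A ∩ Ico T (T + 2 * t * (q + 1)))} : ℝ) := by
        exact_mod_cast (card_le_card hcover).trans ((card_union_le _ _).trans
          (Nat.add_le_add_left card_biUnion_le _))
      _ ≤ _ := by gcongr with q; exact hterm q
  rw [← sum_mul, ← mul_sum] at hsum
  have : (0 : ℝ) ≤ (#W).choose m := by positivity
  nlinarith

lemma card_crowdedSets_le {T n u b k : ℕ} (hk : 0 < k) (hu : 0 < u) (hb : 2 ≤ b)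
    (hcard : 24 * k * u ≤ n - T) :
    (#(crowdedSets T n (2 * u) b k) : ℝ)
      ≤ 4 / 27 * (6 * u * ((k : ℝ) / (n - T : ℕ))) ^ b * (n - T).choose k := by
  classical
  have hNpos : (0 : ℝ) < (n - T : ℕ) := by
    have : 0 < 24 * k * u := by positivity
    exact_mod_cast this.trans_le hcard
  set x : ℝ := (k : ℝ) / (n - T : ℕ) with hx
  have hx0 : 0 ≤ x := by positivity
  have hux : 6 * u * x ≤ 1 / 4 := by
    have : (24 * k * u : ℝ) ≤ (n - T : ℕ) := by exact_mod_cast hcard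
    rw [hx, mul_div_assoc', div_le_iff₀ hNpos]
    linarith
  have hcover : crowdedSets T n (2 * u) b k ⊆ (Ico b (k + 1)).biUnion fun q ↦
        {A ∈ (Ico T n).powersetCard k | q ≤ #(A ∩ Ico T (T + 2 * u * (q - 1)))} := by
    intro A hA
    obtain ⟨hA, q, hbq, hq⟩ := mem_crowdedSets.mp hA
    refine mem_biUnion.mpr ⟨q, ?_, mem_filter.mpr ⟨hA, ?_⟩⟩
    · have h1 := countBelow_le_card A (T + 2 * u * (q - 1))
      have h2 := (mem_powersetCard.mp hA).2
      rw [mem_Ico]; omega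
    · rwa [← countBelow_add_eq (le_of_mem_powersetCard_Ico hA)]
  have hterm (q : ℕ) (hq : b ≤ q) :
      (#{A ∈ (Ico T n).powersetCard k | q ≤ #(A ∩ Ico T (T + 2 * u * (q - 1)))} : ℝ)
      ≤ 1 / 9 * (6 * u * x) ^ q * (n - T).choose k := by
    refine (card_filter_le_card_inter_le (Ico T n) _ k q).trans ?_
    rw [Nat.card_Ico, Nat.card_Ico, ← hx, Nat.add_sub_cancel_left]
    obtain ⟨d, rfl⟩ : ∃ d, q = d + 2 := ⟨q - 2, by omega⟩
    rw [show d + 2 - 1 = d + 1 by omega]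
    gcongr ?_ * _
    calc ((2 * u * (d + 1)).choose (d + 2) : ℝ) * x ^ (d + 2)
        ≤ (((2 * u : ℕ) : ℝ) ^ (d + 2) * 3 ^ d) * x ^ (d + 2) := by
          gcongr; exact choose_mul_succ_le' (2 * u) d
      _ = _ := by
          rw [show (6 * u * x : ℝ) = (2 * u : ℕ) * 3 * x by push_cast; ring, mul_pow, mul_pow,
            pow_add (3 : ℝ)]
          ring
  have hgeom := geom_sum_Ico_le_of_lt_one (m := b) (n := k + 1) (x := (6 * u * x : ℝ))
      (by positivity) (by linarith)
  have hgeom' : ∑ q ∈ Ico b (k + 1), (6 * u * x : ℝ) ^ q ≤ 4 / 3 * (6 * u * x) ^ b := by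
    refine hgeom.trans ?_
    rw [div_le_iff₀ (by linarith)]
    have : (0 : ℝ) ≤ (6 * u * x) ^ b := by positivity
    nlinarith
  calc (#(crowdedSets T n (2 * u) b k) : ℝ) ≤ ∑ q ∈ Ico b (k + 1),
        (#{A ∈ (Ico T n).powersetCard k | q ≤ #(A ∩ Ico T (T + 2 * u * (q - 1)))} : ℝ) := by
        exact_mod_cast (card_le_card hcover).trans card_biUnion_le
    _ ≤ ∑ q ∈ Ico b (k + 1), 1 / 9 * (6 * u * x) ^ q * (n - T).choose k :=
        sum_le_sum fun q hq ↦ hterm q (mem_Ico.mp hq).1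
    _ = 1 / 9 * (∑ q ∈ Ico b (k + 1), (6 * u * x) ^ q) * (n - T).choose k := by
        rw [← sum_mul, ← mul_sum]
    _ ≤ 1 / 9 * (4 / 3 * (6 * u * x) ^ b) * (n - T).choose k := by gcongr
    _ = _ := by ring

lemma div_mul_choose_le_choose {N m : ℕ} (h : m + 1 ≤ N) :
    ((m + 1 : ℕ) : ℝ) / N * N.choose (m + 1) ≤ N.choose m := by
  have hN : (0 : ℝ) < N := by exact_mod_cast (by omega : 0 < N)
  rw [div_mul_eq_mul_div, div_le_iff₀ hN]
  have := Nat.choose_succ_right_eq N m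
  have h2 : N.choose m * (N - m) ≤ N.choose m * N := Nat.mul_le_mul_left _ (Nat.sub_le _ _)
  have h3 : (m + 1) * N.choose (m + 1) ≤ N.choose m * N := by rw [mul_comm]; omega
  exact_mod_cast h3

lemma card_crowdedSets_le_mul_card_sparseSets {T n t u m : ℕ} (hu : 2 ≤ u) (hut : u ≤ t)
    (hcard : 24 * (m + 1) * t ≤ n - T) :
    #(crowdedSets T n (2 * u) 2 (m + 1)) ≤ (u - 1) * #(sparseSets T (2 * t) m (Ico T n)) := by
  have hutm : 24 * (m + 1) * u ≤ n - T := (Nat.mul_le_mul_left _ hut).trans hcard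
  have h1 := card_crowdedSets_le (T := T) (n := n) (k := m + 1) (Nat.succ_pos m)
    (by omega : 0 < u) le_rfl hutm
  have h2 := card_sparseSets_ge (T := T) (t := t) (m := m) (W := Ico T n)
    (fun x hx ↦ (mem_Ico.mp hx).1) (by omega) (by rw [Nat.card_Ico]; nlinarith)
  rw [Nat.card_Ico] at h2
  have hN : m + 1 ≤ n - T := by nlinarith
  have h3 := div_mul_choose_le_choose hN
  have hNpos : (0 : ℝ) < (n - T : ℕ) := by exact_mod_cast (by omega : 0 < n - T)
  set x : ℝ := ((m + 1 : ℕ) : ℝ) / (n - T : ℕ) with hx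
  have hx0 : 0 ≤ x := by positivity
  have hux : u * x ≤ 1 / 24 := by
    have : (24 * (m + 1) * u : ℝ) ≤ (n - T : ℕ) := by exact_mod_cast hutm
    rw [hx, mul_div_assoc', div_le_iff₀ hNpos]
    push_cast
    linarith
  have hu' : (2 : ℝ) ≤ u := by exact_mod_cast hu
  rw [← Nat.cast_le (α := ℝ), Nat.cast_mul, Nat.cast_sub (by omega), Nat.cast_one]
  set C : ℝ := (((n - T).choose (m + 1) : ℕ) : ℝ)
  have hC : 0 ≤ x * C := by positivity
  calc _ ≤ 4 / 27 * (6 * u * x) ^ 2 * C := h1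
    _ = 16 / 3 * (u * x) * (u * (x * C)) := by ring
    _ ≤ 16 / 3 * (1 / 24) * (u * (x * C)) := by gcongr
    _ ≤ (u - 1) * (7 / 8 * (x * C)) := by nlinarith
    _ ≤ (u - 1) * (7 / 8 * (n - T).choose m) := by
        have : (0 : ℝ) ≤ u - 1 := by linarith
        gcongr
    _ ≤ _ := by
        have : (0 : ℝ) ≤ u - 1 := by linarith
        gcongr

lemma card_crowdedSets_le_card_sparseSets {T n t b m : ℕ} (ht : 0 < t) (hb : b ≤ m)
    (hcard : 24 * (m + 1) * t ≤ n - T) :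
    #(crowdedSets T n 2 (b + 2) (m + 1))
      ≤ #(sparseSets T (2 * t) m (Ico (T + 2 * (b + 1)) n)) := by
  have hmt : m + 1 ≤ (m + 1) * t := Nat.le_mul_of_pos_right _ ht
  have hcard' : 24 * ((m + 1) * t) ≤ n - T := by rwa [← mul_assoc]
  have h1 := card_crowdedSets_le (T := T) (n := n) (k := m + 1) (u := 1) (b := b + 2)
    (Nat.succ_pos m) one_pos (by omega) (by omega)
  have h2 := card_sparseSets_ge (T := T) (t := t) (m := m) (W := Ico (T + 2 * (b + 1)) n)
    (fun x hx ↦ by rw [mem_Ico] at hx; omega) ht (by rw [Nat.card_Ico, mul_assoc]; omega)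
  rw [Nat.card_Ico, ← Nat.sub_sub] at h2
  have h3 := div_mul_choose_le_choose (by omega : m + 1 ≤ n - T)
  have h4 := pow_mul_choose_le_choose_sub (n - T) m (2 * (b + 1)) (by omega)
  have hNpos : (0 : ℝ) < (n - T : ℕ) := by exact_mod_cast (by omega : 0 < n - T)
  set x : ℝ := ((m + 1 : ℕ) : ℝ) / (n - T : ℕ) with hx
  have hx0 : 0 ≤ x := by positivity
  have hux : 6 * x ≤ 1 / 4 := by
    have : ((24 * (m + 1) : ℕ) : ℝ) ≤ (n - T : ℕ) := by exact_mod_cast (by omega)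
    rw [hx, mul_div_assoc', div_le_iff₀ hNpos]
    push_cast at this ⊢
    linarith
  rw [← Nat.cast_le (α := ℝ)]
  set C : ℝ := (((n - T).choose (m + 1) : ℕ) : ℝ)
  have hC : 0 ≤ x * C := by positivity
  rw [mul_one] at h1
  calc _ ≤ 4 / 27 * (6 * (1 : ℕ) * x) ^ (b + 2) * C := h1
    _ = 8 / 9 * (6 * x) ^ (b + 1) * (x * C) := by push_cast; ring
    _ ≤ 8 / 9 * (1 / 4) ^ (b + 1) * (x * C) := by gcongr
    _ = 2 / 9 * (1 / 4) ^ b * (x * C) := by ring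
    _ ≤ 2 / 9 * ((19 / 20) ^ 2) ^ b * (x * C) := by gcongr; norm_num
    _ ≤ 7 / 8 * (((19 / 20) ^ 2) * ((19 / 20) ^ 2) ^ b) * (x * C) := by
        gcongr ?_ * _
        have : (0 : ℝ) ≤ ((19 / 20) ^ 2) ^ b := by positivity
        nlinarith
    _ = 7 / 8 * ((19 / 20) ^ (2 * (b + 1)) * (x * C)) := by rw [pow_mul, pow_succ']; ring
    _ ≤ 7 / 8 * ((19 / 20) ^ (2 * (b + 1)) * (n - T).choose m) := by gcongr
    _ ≤ 7 / 8 * (n - T - 2 * (b + 1)).choose m := by gcongr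
    _ ≤ _ := h2

lemma mul_card_lt_card_inter_of_forall_insert_notMem {T n m M : ℕ} (hT : T ≤ n)
    {F 𝒜 : Finset (Finset ℕ)} (hF : F ⊆ (range n).powersetCard (m + 1))
    (hFcard : n.choose (m + 1) - (n - T).choose (m + 1) < #F)
    (h𝒜 : 𝒜 ⊆ (Ico T n).powersetCard m)
    (hno : ∀ j, M ≤ j → j < T → ∀ A ∈ 𝒜, insert j A ∉ F) :
    (T - M) * #𝒜 < #(F ∩ (Ico T n).powersetCard (m + 1)) := by
  have hlow {A : Finset ℕ} (hA : A ∈ 𝒜) : ∀ x ∈ A, T ≤ x := le_of_mem_powersetCard_Ico (h𝒜 hA)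
  set O := (Ico T n).powersetCard (m + 1) with hO
  set B := (Ico M T ×ˢ 𝒜).image fun p ↦ insert p.1 p.2 with hB
  have hBmem {A : Finset ℕ} (hA : A ∈ B) : ∃ j, M ≤ j ∧ j < T ∧ ∃ A' ∈ 𝒜, insert j A' = A := by
    obtain ⟨⟨j, A'⟩, hp, rfl⟩ := mem_image.mp hA
    rw [mem_product, mem_Ico] at hp
    exact ⟨j, hp.1.1, hp.1.2, A', hp.2, rfl⟩
  have hBcard : #B = (T - M) * #𝒜 := by
    rw [hB, card_image_of_injOn, card_product, Nat.card_Ico]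
    rintro ⟨i, A⟩ hA ⟨j, A'⟩ hA' h
    simp only [coe_product, Set.mem_prod, mem_coe, mem_Ico] at hA hA'
    have h1 := hlow hA.2
    have h2 := hlow hA'.2
    have h3 (x : ℕ) : x ∈ insert i A ↔ x ∈ insert j A' := by
      simp only at h; rw [h]
    simp only [mem_insert] at h3
    have hij : i = j := by
      have := (h3 i).mp (.inl rfl)
      rcases this with h | h
      · exact h
      · have := h2 i h; omega
    subst hij
    congr 1
    ext x
    have := h3 x
    constructor
    · intro hx; have := h1 x hx; grind
    · intro hx; have := h2 x hx; grind
  have hFB : Disjoint (F \ O) B := by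
    rw [disjoint_left]
    intro A hA hAB
    obtain ⟨j, hMj, hjT, A', hA', rfl⟩ := hBmem hAB
    exact hno j hMj hjT A' hA' (mem_sdiff.mp hA).1
  have hOB : Disjoint (F \ O ∪ B) O := by
    rw [disjoint_union_left]
    refine ⟨sdiff_disjoint, disjoint_left.mpr fun A hA hAO ↦ ?_⟩
    obtain ⟨j, hMj, hjT, A', hA', rfl⟩ := hBmem hA
    have := le_of_mem_powersetCard_Ico hAO j (mem_insert_self _ _)
    omega
  have hsub : F \ O ∪ B ∪ O ⊆ (range n).powersetCard (m + 1) := by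
    refine union_subset (union_subset (sdiff_subset.trans hF) fun A hA ↦ ?_) ?_
    · obtain ⟨j, hMj, hjT, A', hA', rfl⟩ := hBmem hA
      have h1 := mem_powersetCard.mp (h𝒜 hA')
      have hj : j ∉ A' := fun h ↦ by have := hlow hA' j h; omega
      rw [mem_powersetCard, card_insert_of_notMem hj, h1.2]
      refine ⟨fun x hx ↦ ?_, rfl⟩
      rcases mem_insert.mp hx with rfl | hx
      · rw [mem_range]; omega
      · exact mem_range.mpr (mem_Ico.mp (h1.1 hx)).2
    · exact powersetCard_mono fun x hx ↦ mem_range.mpr (mem_Ico.mp hx).2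
  have h1 := card_le_card hsub
  have hOcard : #O = (n - T).choose (m + 1) := by rw [hO, card_powersetCard, Nat.card_Ico]
  rw [card_union_of_disjoint hOB, card_union_of_disjoint hFB, hBcard, hOcard,
    card_powersetCard, card_range] at h1
  have h2 := card_sdiff_add_card_inter F O
  omega

lemma IsShifted.insert_mem_of_le {F : Finset (Finset ℕ)} (hF : IsShifted F) {T j l : ℕ}
    {A : Finset ℕ} (hA : ∀ x ∈ A, T ≤ x) (hjl : j ≤ l) (hl : l < T) (h : insert l A ∈ F) :
    insert j A ∈ F := by
  rcases hjl.eq_or_lt with rfl | hjl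
  · exact h
  have hlA : l ∉ A := fun h ↦ by have := hA l h; omega
  have hjA : j ∉ A := fun h ↦ by have := hA j h; omega
  have := hF _ h j l hjl (mem_insert_self _ _) (by simp [hjl.ne, hjA])
  rwa [erase_insert hlA] at this

lemma exists_insert_mem_or_mul_card_lt {T n m M : ℕ} (hT : T ≤ n) {F 𝒜 : Finset (Finset ℕ)}
    (hF : F ⊆ (range n).powersetCard (m + 1)) (hs : IsShifted F)
    (hFcard : n.choose (m + 1) - (n - T).choose (m + 1) < #F)
    (h𝒜 : 𝒜 ⊆ (Ico T n).powersetCard m) :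
    (∃ A ∈ 𝒜, insert M A ∈ F) ∨
      (T - M) * #𝒜 < #(F ∩ (Ico T n).powersetCard (m + 1)) := by
  by_cases h : ∃ A ∈ 𝒜, insert M A ∈ F
  · exact .inl h
  · refine .inr (mul_card_lt_card_inter_of_forall_insert_notMem hT hF hFcard h𝒜 ?_)
    intro j hMj hjT A hA hjA
    exact h ⟨A, hA, hs.insert_mem_of_le (le_of_mem_powersetCard_Ico (h𝒜 hA)) hMj hjT hjA⟩

/-- Rainbow matchings in which the families in `S` use sets `insert (j i) (A i)` with distinct small
elements `j i`, and the other families use sets contained in `[T, ∞)`. -/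
lemma hasRainbowMatching_of_sum_add_sum_le {ι : Type*} [Fintype ι] [DecidableEq ι]
    {F : ι → Finset (Finset ℕ)} (hF : ∀ i, IsShifted (F i)) {T : ℕ} (S : Finset ι) (j : ι → ℕ)
    (hj : Set.InjOn j S) (A : ι → Finset ℕ) (hA : ∀ i, ∀ x ∈ A i, T ≤ x)
    (hAS : ∀ i ∈ S, insert (j i) (A i) ∈ F i) (hAS' : ∀ i ∉ S, A i ∈ F i)
    (hc : ∀ p, #S + (∑ i ∈ S, countBelow (A i) (T + p) + ∑ i ∈ Sᶜ, countBelow (A i) (T + p))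
      ≤ T + p) :
    HasRainbowMatching F := by
  refine hasRainbowMatching_of_sum_countBelow_le hF
    (fun i ↦ if i ∈ S then insert (j i) (A i) else A i) (fun i ↦ ?_) fun l ↦ ?_
  · split_ifs with h
    · exact hAS i h
    · exact hAS' i h
  rw [← sum_add_sum_compl S]
  have h1 : ∑ i ∈ S, countBelow (if i ∈ S then insert (j i) (A i) else A i) l
      ≤ ∑ i ∈ S, countBelow (A i) l + #{i ∈ S | j i < l} := by
    rw [card_filter, ← sum_add_distrib]
    refine sum_le_sum fun i hi ↦ ?_
    rw [if_pos hi]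
    exact countBelow_insert_le _ _ _
  have h2 : ∑ i ∈ Sᶜ, countBelow (if i ∈ S then insert (j i) (A i) else A i) l
      = ∑ i ∈ Sᶜ, countBelow (A i) l :=
    sum_congr rfl fun i hi ↦ by rw [if_neg (mem_compl.mp hi)]
  rw [h2]
  rcases le_total T l with hl | hl
  · obtain ⟨p, rfl⟩ := Nat.exists_eq_add_of_le hl
    have h3 : #{i ∈ S | j i < T + p} ≤ #S := card_filter_le _ _
    have := hc p
    omega
  · have h0 (i : ι) : countBelow (A i) l = 0 :=
      countBelow_eq_zero fun x hx ↦ hl.trans (hA i x hx)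
    have h3 : #{i ∈ S | j i < l} ≤ l := by
      conv_rhs => rw [← card_range l]
      refine card_le_card_of_injOn j (fun i hi ↦ ?_) (hj.mono fun i hi ↦ ?_)
      · simp only [coe_filter, Set.mem_ofPred_eq] at hi; simpa using hi.2
      · simp only [coe_filter, Set.mem_ofPred_eq] at hi; exact hi.1
    simp only [h0, sum_const_zero] at h1 ⊢
    omega

lemma two_mul_sum_le {ι : Type*} {S : Finset ι} {a : ι → ℕ} {t u p : ℕ} (hS : #S + u = t)
    (ht : 0 < t) (hp : 2 * t ≤ p) (ha : ∀ i ∈ S, 2 * t * a i ≤ p) :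
    2 * ∑ i ∈ S, a i + 2 * u ≤ p := by
  have h1 : ∑ i ∈ S, 2 * t * a i ≤ #S * p := sum_le_card_nsmul _ _ _ ha
  rw [← mul_sum] at h1
  refine Nat.le_of_mul_le_mul_left ?_ ht
  have h2 : u * (2 * t) ≤ u * p := Nat.mul_le_mul_left u hp
  calc t * (2 * ∑ i ∈ S, a i + 2 * u) = 2 * t * ∑ i ∈ S, a i + u * (2 * t) := by ring
    _ ≤ #S * p + u * p := Nat.add_le_add h1 h2
    _ = t * p := by rw [← hS]; ring

lemma eq_zero_of_mul_le {t a p : ℕ} (hp : p < 2 * t) (ha : 2 * t * a ≤ p) : a = 0 := by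
  by_contra h
  have : 2 * t * 1 ≤ 2 * t * a := Nat.mul_le_mul_left _ (by omega)
  omega

/-- A set which is not crowded has few elements in initial segments of `[T, n)`. -/
lemma mul_pred_countBelow_le {T n c b k p : ℕ} {E : Finset ℕ}
    (hE : E ∈ (Ico T n).powersetCard k) (h : E ∉ crowdedSets T n c b k)
    (hb : b ≤ countBelow E (T + p)) : c * (countBelow E (T + p) - 1) ≤ p := by
  by_contra! hlt
  exact h (mem_crowdedSets.mpr ⟨hE, _, hb, countBelow_mono_right E (by omega)⟩)

lemma mem_crowdedSets_of_le {T n c c' b k : ℕ} {E : Finset ℕ} (hc : c ≤ c')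
    (h : E ∈ crowdedSets T n c b k) : E ∈ crowdedSets T n c' b k := by
  obtain ⟨hE, q, hbq, hq⟩ := mem_crowdedSets.mp h
  refine mem_crowdedSets.mpr ⟨hE, q, hbq, hq.trans (countBelow_mono_right E ?_)⟩
  have := Nat.mul_le_mul_right (q - 1) hc
  omega

lemma hasRainbowMatching_of_sparse_of_not_crowded {ι : Type*} [Fintype ι] [DecidableEq ι]
    {F : ι → Finset (Finset ℕ)} (hF : ∀ i, IsShifted (F i)) {T n m u : ℕ}
    (hι : Fintype.card ι = T + 1) (S : Finset ι) (hu : 0 < u) (hS : #S + u = T + 1) (j : ι → ℕ)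
    (hj : Set.InjOn j S)
    (hSF : ∀ i ∈ S, ∃ A ∈ sparseSets T (2 * (T + 1)) m (Ico T n), insert (j i) A ∈ F i)
    (hSF' : ∀ i ∉ S, ∃ E ∈ F i, E ∈ (Ico T n).powersetCard (m + 1) ∧
      E ∉ crowdedSets T n (2 * u) 2 (m + 1)) :
    HasRainbowMatching F := by
  have hex (i : ι) : ∃ A : Finset ℕ, (∀ x ∈ A, T ≤ x) ∧
      (i ∈ S → A ∈ sparseSets T (2 * (T + 1)) m (Ico T n) ∧ insert (j i) A ∈ F i) ∧
      (i ∉ S → A ∈ F i ∧ A ∈ (Ico T n).powersetCard (m + 1) ∧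
        A ∉ crowdedSets T n (2 * u) 2 (m + 1)) := by
    by_cases hi : i ∈ S
    · obtain ⟨A, hA, hAF⟩ := hSF i hi
      exact ⟨A, le_of_mem_powersetCard_Ico (mem_sparseSets.mp hA).1, fun _ ↦ ⟨hA, hAF⟩,
        fun h ↦ absurd hi h⟩
    · obtain ⟨E, hE, hEn, hEc⟩ := hSF' i hi
      exact ⟨E, le_of_mem_powersetCard_Ico hEn, fun h ↦ absurd h hi, fun _ ↦ ⟨hE, hEn, hEc⟩⟩
  choose A hAT hAS hAS' using hex
  refine hasRainbowMatching_of_sum_add_sum_le hF S j hj A hAT (fun i hi ↦ (hAS i hi).2)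
    (fun i hi ↦ (hAS' i hi).1) fun p ↦ ?_
  have ha (i : ι) (hi : i ∈ S) : 2 * (T + 1) * countBelow (A i) (T + p) ≤ p :=
    (mem_sparseSets.mp (hAS i hi).1).2 p
  have hcompl : #Sᶜ = u := by rw [card_compl, hι]; omega
  have hc (i : ι) (hi : i ∈ Sᶜ) : 2 * u * countBelow (A i) (T + p) ≤ p + 2 * u := by
    obtain ⟨-, hE, hEc⟩ := hAS' i (mem_compl.mp hi)
    rcases le_or_gt 2 (countBelow (A i) (T + p)) with h | h
    · have h1 := mul_pred_countBelow_le hE hEc h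
      obtain ⟨d, hd⟩ : ∃ d, countBelow (A i) (T + p) = d + 1 := ⟨_, (Nat.sub_add_cancel
        (by omega : 1 ≤ countBelow (A i) (T + p))).symm⟩
      rw [hd, Nat.add_sub_cancel] at h1
      rw [hd, mul_add]
      omega
    · have : 2 * u * countBelow (A i) (T + p) ≤ 2 * u * 1 := Nat.mul_le_mul_left _ (by omega)
      omega
  have hcsum : 2 * ∑ i ∈ Sᶜ, countBelow (A i) (T + p) ≤ p + 2 * u := by
    have h1 : ∑ i ∈ Sᶜ, 2 * u * countBelow (A i) (T + p) ≤ #Sᶜ * (p + 2 * u) :=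
      sum_le_card_nsmul _ _ _ hc
    rw [← mul_sum, hcompl] at h1
    refine Nat.le_of_mul_le_mul_left ?_ hu
    calc u * (2 * ∑ i ∈ Sᶜ, countBelow (A i) (T + p))
        = 2 * u * ∑ i ∈ Sᶜ, countBelow (A i) (T + p) := by ring
      _ ≤ _ := h1
  have hcsum' : ∑ i ∈ Sᶜ, countBelow (A i) (T + p) ≤ u * p := by
    rw [← hcompl]
    exact sum_le_card_nsmul _ _ _ fun i _ ↦ countBelow_add_le (hAT i) p
  rcases lt_or_ge p (2 * (T + 1)) with hp | hp
  · rw [sum_eq_zero fun i hi ↦ eq_zero_of_mul_le hp (ha i hi)]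
    rcases (by omega : p = 0 ∨ p = 1 ∨ 2 ≤ p) with rfl | rfl | h
    · omega
    · omega
    · omega
  · have := two_mul_sum_le hS (Nat.succ_pos T) hp ha
    omega

/-- If all members contained in `[T, n)` of all the families are crowded, then a least crowded one
extends to a rainbow matching. -/
lemma hasRainbowMatching_of_crowded {ι : Type*} [Fintype ι] [DecidableEq ι]
    {F : ι → Finset (Finset ℕ)} (hs : ∀ i, IsShifted (F i)) {T n m b : ℕ}
    (hι : Fintype.card ι = T + 1) (hT : T ≤ n) (hcard : 24 * (m + 1) * (T + 1) ≤ n - T)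
    (hF : ∀ i, F i ⊆ (range n).powersetCard (m + 1))
    (hFcard : ∀ i, n.choose (m + 1) - (n - T).choose (m + 1) < #(F i))
    (hcr : ∀ i, ∀ E ∈ F i, E ∈ (Ico T n).powersetCard (m + 1) →
      E ∈ crowdedSets T n 2 (b + 2) (m + 1))
    {r : ι} {E : Finset ℕ} (hE : E ∈ F r) (hEn : E ∈ (Ico T n).powersetCard (m + 1))
    (hEc : E ∉ crowdedSets T n 2 (b + 3) (m + 1)) : HasRainbowMatching F := by
  have hb : b ≤ m := by
    obtain ⟨-, q, hbq, hq⟩ := mem_crowdedSets.mp (hcr r E hE hEn)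
    have := countBelow_le_card E (T + 2 * (q - 1))
    have := (mem_powersetCard.mp hEn).2
    omega
  have hcount := card_crowdedSets_le_card_sparseSets (T := T) (n := n) (Nat.succ_pos T) hb hcard
  set 𝒜 := sparseSets T (2 * (T + 1)) m (Ico (T + 2 * (b + 1)) n) with h𝒜def
  have h𝒜low {A : Finset ℕ} (hA : A ∈ 𝒜) : ∀ x ∈ A, T + 2 * (b + 1) ≤ x :=
    le_of_mem_powersetCard_Ico (mem_sparseSets.mp hA).1
  have h𝒜 : 𝒜 ⊆ (Ico T n).powersetCard m := fun A hA ↦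
    powersetCard_mono (Ico_subset_Ico_left (by omega)) (mem_sparseSets.mp hA).1
  have hA (i : ι) (hi : i ≠ r) : ∃ A ∈ 𝒜, insert (T - 1) A ∈ F i := by
    refine (exists_insert_mem_or_mul_card_lt hT (hF i) (hs i) (hFcard i) h𝒜).resolve_right ?_
    have hT0 : 1 < Fintype.card ι := Fintype.one_lt_card_iff.mpr ⟨i, r, hi⟩
    have h1 : #(F i ∩ (Ico T n).powersetCard (m + 1)) ≤ #𝒜 :=
      (card_le_card fun B hB ↦ hcr i B (mem_inter.mp hB).1 (mem_inter.mp hB).2).trans hcount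
    have h2 : T - (T - 1) = 1 := by omega
    rw [h2, one_mul]
    omega
  have hex (i : ι) : ∃ A : Finset ℕ, (i ≠ r → A ∈ 𝒜 ∧ insert (T - 1) A ∈ F i) ∧
      (i = r → A = E) := by
    by_cases hi : i = r
    · exact ⟨E, fun h ↦ absurd hi h, fun _ ↦ rfl⟩
    · obtain ⟨A, h1, h2⟩ := hA i hi
      exact ⟨A, fun _ ↦ ⟨h1, h2⟩, fun h ↦ absurd h hi⟩
  choose A hA1 hA2 using hex
  have hAr : A r = E := hA2 r rfl
  set S : Finset ι := univ.erase r with hSdef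
  have hS : #S = T := by rw [hSdef, card_erase_of_mem (mem_univ r), card_univ, hι]; rfl
  have hSr {i : ι} (hi : i ∈ S) : i ≠ r := (mem_erase.mp hi).1
  have hScompl : Sᶜ = {r} := by ext; simp [hSdef]
  have hElow := le_of_mem_powersetCard_Ico hEn
  have hAT (i : ι) : ∀ x ∈ A i, T ≤ x := by
    by_cases hi : i = r
    · rw [hA2 i hi]; exact hElow
    · exact le_of_mem_powersetCard_Ico (h𝒜 (hA1 i hi).1)
  obtain ⟨j, hjS, hj⟩ : ∃ j : ι → ℕ, Set.MapsTo j S (range T : Finset ℕ) ∧ Set.InjOn j S := by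
    have e := S.equivFinOfCardEq hS
    refine ⟨fun i ↦ if h : i ∈ S then e ⟨i, h⟩ else 0, fun i hi ↦ ?_, fun i hi l hl h ↦ ?_⟩
    · rw [mem_coe] at hi
      simp [hi]
    · rw [mem_coe] at hi hl
      simp only [hi, hl, dif_pos] at h
      simpa using e.injective (Fin.val_injective h)
  refine hasRainbowMatching_of_sum_add_sum_le hs S j hj A hAT (fun i hi ↦ ?_) (fun i hi ↦ ?_)
    fun p ↦ ?_
  · have := hjS hi
    simp only [coe_range, Set.mem_Iio] at this
    exact (hs i).insert_mem_of_le (hAT i) (by omega) (by omega) (hA1 i (hSr hi)).2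
  · have : i = r := by simpa [hSdef] using hi
    rw [hA2 i this, this]
    exact hE
  · rw [hScompl, sum_singleton, hAr, hS]
    have ha (i : ι) (hi : i ∈ S) : 2 * (T + 1) * countBelow (A i) (T + p) ≤ p :=
      (mem_sparseSets.mp (hA1 i (hSr hi)).1).2 p
    have hEp := countBelow_add_le hElow p
    rcases le_or_gt p (2 * (b + 1)) with hpb | hpb
    · rw [sum_eq_zero fun i hi ↦ countBelow_eq_zero fun x hx ↦ ?_]
      · omega
      · have := h𝒜low (hA1 i (hSr hi)).1 x hx
        omega
    have hEp' : 2 * (countBelow E (T + p) - 1) ≤ p := by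
      rcases le_or_gt (b + 3) (countBelow E (T + p)) with h | h
      · exact mul_pred_countBelow_le hEn hEc h
      · omega
    rcases lt_or_ge p (2 * (T + 1)) with hp | hp
    · rw [sum_eq_zero fun i hi ↦ eq_zero_of_mul_le hp (ha i hi)]
      omega
    · have := two_mul_sum_le (u := 1) (by omega) (Nat.succ_pos T) hp ha
      omega

/-- If some family has a member in `[T, n)` which is not crowded, then there is a rainbow matching:
choose as many families as possible which can use the small elements. -/
lemma hasRainbowMatching_of_not_crowded {ι : Type*} [Fintype ι] [DecidableEq ι]
    {F : ι → Finset (Finset ℕ)} (hs : ∀ i, IsShifted (F i)) {T n m : ℕ}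
    (hι : Fintype.card ι = T + 1) (hT : T ≤ n) (hcard : 24 * (m + 1) * (T + 1) ≤ n - T)
    (hF : ∀ i, F i ⊆ (range n).powersetCard (m + 1))
    (hFcard : ∀ i, n.choose (m + 1) - (n - T).choose (m + 1) < #(F i))
    {r : ι} {E : Finset ℕ} (hE : E ∈ F r) (hEn : E ∈ (Ico T n).powersetCard (m + 1))
    (hEc : E ∉ crowdedSets T n 2 2 (m + 1)) : HasRainbowMatching F := by
  classical
  set 𝒜 := sparseSets T (2 * (T + 1)) m (Ico T n) with h𝒜def
  have h𝒜 : 𝒜 ⊆ (Ico T n).powersetCard m := fun A hA ↦ (mem_sparseSets.mp hA).1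
  let Good (S : Finset ι) : Prop := ∃ j : ι → ℕ, Set.InjOn j S ∧
    ∀ i ∈ S, j i < #S ∧ ∃ A ∈ 𝒜, insert (j i) A ∈ F i
  have hgood_insert {S : Finset ι} (hS : Good S) {i : ι} (hi : i ∉ S)
      (h : ∃ A ∈ 𝒜, insert (#S) A ∈ F i) : Good (insert i S) := by
    obtain ⟨j, hj, hjS⟩ := hS
    have hne {l : ι} (hl : l ∈ S) : l ≠ i := fun h ↦ hi (h ▸ hl)
    refine ⟨Function.update j i (#S), ?_, fun l hl ↦ ?_⟩
    · intro l hl l' hl' heq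
      simp only [coe_insert, Set.mem_insert_iff, mem_coe] at hl hl'
      rcases hl with rfl | hl <;> rcases hl' with rfl | hl'
      · rfl
      · rw [Function.update_self, Function.update_of_ne (hne hl')] at heq
        have := (hjS l' hl').1; omega
      · rw [Function.update_self, Function.update_of_ne (hne hl)] at heq
        have := (hjS l hl).1; omega
      · rw [Function.update_of_ne (hne hl), Function.update_of_ne (hne hl')] at heq
        exact hj hl hl' heq
    · rw [card_insert_of_notMem hi]
      rcases mem_insert.mp hl with rfl | hl
      · rw [Function.update_self]; exact ⟨by omega, h⟩
      · rw [Function.update_of_ne (hne hl)]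
        exact ⟨by have := (hjS l hl).1; omega, (hjS l hl).2⟩
  have hfin {S : Finset ι} (hS : Good S) {u : ℕ} (hu : 0 < u) (hSu : #S + u = T + 1)
      (hSF : ∀ i ∉ S, ∃ E ∈ F i, E ∈ (Ico T n).powersetCard (m + 1) ∧
        E ∉ crowdedSets T n (2 * u) 2 (m + 1)) : HasRainbowMatching F := by
    obtain ⟨j, hj, hjS⟩ := hS
    exact hasRainbowMatching_of_sparse_of_not_crowded hs hι S hu hSu j hj
      (fun i hi ↦ (hjS i hi).2) hSF
  obtain ⟨S, hS, hmax⟩ := exists_max_image {S : Finset ι | r ∉ S ∧ Good S} card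
    ⟨∅, by simp [Good]⟩
  simp only [mem_filter, mem_univ, true_and] at hS hmax
  obtain ⟨hrS, hS⟩ := hS
  have hScard : #S ≤ T := by
    have := card_lt_univ_of_notMem hrS
    omega
  have hnoncrowded {i : ι} (hi : ¬ ∃ A ∈ 𝒜, insert (#S) A ∈ F i) (hST : #S < T) :
      ∃ E ∈ F i, E ∈ (Ico T n).powersetCard (m + 1) ∧
        E ∉ crowdedSets T n (2 * (T + 1 - #S)) 2 (m + 1) := by
    have h1 := (exists_insert_mem_or_mul_card_lt hT (hF i) (hs i) (hFcard i) h𝒜).resolve_left hi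
    have h2 := card_crowdedSets_le_mul_card_sparseSets (T := T) (n := n) (t := T + 1)
      (u := T + 1 - #S) (m := m) (by omega) (by omega) hcard
    rw [show T + 1 - #S - 1 = T - #S by omega] at h2
    obtain ⟨E, hE, hEc⟩ := exists_mem_notMem_of_card_lt_card (h2.trans_lt h1)
    exact ⟨E, (mem_inter.mp hE).1, (mem_inter.mp hE).2, hEc⟩
  have hothers {i : ι} (hi : i ∉ S) (hir : i ≠ r) : ¬ ∃ A ∈ 𝒜, insert (#S) A ∈ F i := by
    intro h
    have := hmax (insert i S) ⟨by simp [hrS, hir.symm], hgood_insert hS hi h⟩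
    rw [card_insert_of_notMem hi] at this
    omega
  rcases hScard.eq_or_lt with hST | hST
  · refine hfin hS one_pos (by omega) fun i hi ↦ ?_
    have : i = r := by
      have hu : insert r S = univ := by
        rw [← card_eq_iff_eq_univ, card_insert_of_notMem hrS]; omega
      have := mem_univ i
      rw [← hu, mem_insert] at this
      tauto
    subst this
    exact ⟨E, hE, hEn, by simpa using hEc⟩
  by_cases hr : ∃ A ∈ 𝒜, insert (#S) A ∈ F r
  · refine hfin (hgood_insert hS hrS hr) (u := T - #S) (by omega)
      (by rw [card_insert_of_notMem hrS]; omega) fun i hi ↦ ?_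
    simp only [mem_insert, not_or] at hi
    obtain ⟨E, h1, h2, h3⟩ := hnoncrowded (hothers hi.2 hi.1) hST
    exact ⟨E, h1, h2, fun h ↦ h3 (mem_crowdedSets_of_le (by omega) h)⟩
  · refine hfin hS (u := T + 1 - #S) (by omega) (by omega) fun i hi ↦ ?_
    by_cases hir : i = r
    · exact hnoncrowded (hir ▸ hr) hST
    · exact hnoncrowded (hothers hi hir) hST

/-- Rainbow matchings in shifted families. -/
theorem hasRainbowMatching_of_isShifted {ι : Type*} [Fintype ι] [DecidableEq ι]
    {F : ι → Finset (Finset ℕ)} (hs : ∀ i, IsShifted (F i)) {T n m : ℕ}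
    (hι : Fintype.card ι = T + 1) (hT : T ≤ n) (hcard : 24 * (m + 1) * (T + 1) ≤ n - T)
    (hF : ∀ i, F i ⊆ (range n).powersetCard (m + 1))
    (hFcard : ∀ i, n.choose (m + 1) - (n - T).choose (m + 1) < #(F i)) :
    HasRainbowMatching F := by
  classical
  obtain ⟨r⟩ : Nonempty ι := Fintype.card_pos_iff.mp (by omega)
  have hex : ∃ c, ∃ i, ∃ E ∈ F i, E ∈ (Ico T n).powersetCard (m + 1) ∧
      E ∉ crowdedSets T n 2 c (m + 1) := by
    have h := mul_card_lt_card_inter_of_forall_insert_notMem (M := T) (𝒜 := ∅) hT (hF r)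
      (hFcard r) (by simp) (by simp)
    obtain ⟨E, hE⟩ := card_pos.mp ((Nat.zero_le _).trans_lt h)
    obtain ⟨hE, hEn⟩ := mem_inter.mp hE
    refine ⟨m + 2, r, E, hE, hEn, fun hEc ↦ ?_⟩
    obtain ⟨-, q, hbq, hq⟩ := mem_crowdedSets.mp hEc
    have := countBelow_le_card E (T + 2 * (q - 1))
    have := (mem_powersetCard.mp hEn).2
    omega
  obtain ⟨i, E, hE, hEn, hEc⟩ := Nat.find_spec hex
  rcases le_or_gt (Nat.find hex) 2 with h | h
  · refine hasRainbowMatching_of_not_crowded hs hι hT hcard hF hFcard hE hEn fun hc ↦ hEc ?_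
    obtain ⟨-, q, hbq, hq⟩ := mem_crowdedSets.mp hc
    exact mem_crowdedSets.mpr ⟨hEn, q, by omega, hq⟩
  · obtain ⟨b, hb⟩ : ∃ b, Nat.find hex = b + 3 := ⟨Nat.find hex - 3, by omega⟩
    rw [hb] at hEc
    refine hasRainbowMatching_of_crowded hs hι hT hcard hF hFcard (b := b) ?_ hE hEn hEc
    intro l B hB hBn
    have := Nat.find_min hex (by omega : b + 2 < Nat.find hex)
    by_contra hBc
    exact this ⟨l, B, hB, hBn, hBc⟩

lemma mul_le_sub_pred_of_log_le {n k t : ℕ} (hk : 0 < k) (ht : 0 < t)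
    (h : 12 * (k : ℝ) * t * Real.log (Real.exp 2 * t) ≤ (n : ℝ)) :
    24 * k * t + (t - 1) ≤ n := by
  have ht' : (0 : ℝ) < t := by exact_mod_cast ht
  have hk' : (1 : ℝ) ≤ k := by exact_mod_cast hk
  have ht1 : (1 : ℝ) ≤ t := by exact_mod_cast ht
  rw [Real.log_mul (Real.exp_pos 2).ne' ht'.ne', Real.log_exp] at h
  have h1 : 1 - (t : ℝ)⁻¹ ≤ Real.log t := Real.one_sub_inv_le_log_of_pos ht'
  have h2 : (t : ℝ) - 1 ≤ t * Real.log t := by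
    have := mul_le_mul_of_nonneg_left h1 ht'.le
    rwa [mul_sub, mul_one, mul_inv_cancel₀ ht'.ne'] at this
  have h3 : (24 * k * t + (t - 1) : ℝ) ≤ n := by
    have h4 : (k : ℝ) * (t - 1) ≤ k * (t * Real.log t) := by gcongr
    nlinarith [mul_nonneg (sub_nonneg.mpr hk') (sub_nonneg.mpr ht1)]
  have h5 : ((24 * k * t + (t - 1) : ℕ) : ℝ) ≤ n := by
    rw [Nat.cast_add, Nat.cast_sub ht]; push_cast; exact h3
  exact_mod_cast h5

/-- Result of Frankl and Kupavskii: if `n ≥ 12·k·t·ln(e²t)` and each `F_i ⊆ C([n],k)`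
satisfies `|F_i| > C(n,k) - C(n-t+1,k)`, then `{F₁,…,F_t}` admits a rainbow matching. -/
theorem stmt_15 (n k t : ℕ) (hn : 0 < n) (hk : 0 < k) (ht : 0 < t)
    (hnkt : 12 * (k : ℝ) * t * Real.log (Real.exp 2 * t) ≤ (n : ℝ))
    (F : Fin t → Finset (Finset (Fin n)))
    (hF : ∀ i, F i ⊆ Finset.univ.powersetCard k)
    (hFcard : ∀ i, Nat.choose n k - Nat.choose (n - t + 1) k < (F i).card) :
    ∃ e : Fin t → Finset (Fin n),
      (∀ i, e i ∈ F i) ∧ ∀ i j, i ≠ j → Disjoint (e i) (e j) := by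
  have hbound := mul_le_sub_pred_of_log_le hk ht hnkt
  obtain ⟨m, rfl⟩ : ∃ m, k = m + 1 := ⟨k - 1, by omega⟩
  obtain ⟨T, rfl⟩ : ∃ T, t = T + 1 := ⟨t - 1, by omega⟩
  have hpos : T + 1 ≤ 24 * (m + 1) * (T + 1) := Nat.le_mul_of_pos_left _ (by positivity)
  rw [show n - (T + 1) + 1 = n - T by omega] at hFcard
  have hG (i : Fin (T + 1)) : (F i).map (mapEmbedding Fin.valEmbedding).toEmbedding ⊆
      (range n).powersetCard (m + 1) := by
    intro A hA
    obtain ⟨B, hB, rfl⟩ := mem_map.mp hA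
    have hB' := (mem_powersetCard.mp (hF i hB)).2
    rw [mem_powersetCard, RelEmbedding.coe_toEmbedding, mapEmbedding_apply, card_map]
    refine ⟨fun x hx ↦ ?_, hB'⟩
    obtain ⟨y, -, rfl⟩ := mem_map.mp hx
    simp
  obtain ⟨e, he, hd⟩ := hasRainbowMatching_of_forall_isShifted
    (fun G hG hGc hGs ↦ hasRainbowMatching_of_isShifted hGs (Fintype.card_fin _)
      (by omega) (by omega) hG fun i ↦ by rw [hGc]; exact hFcard i)
    _ hG fun i ↦ card_map _
  simp only [mem_map, RelEmbedding.coe_toEmbedding, mapEmbedding_apply] at he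
  choose e' he' hee' using he
  refine ⟨e', he', fun i j hij ↦ ?_⟩
  have := hd i j hij
  rwa [← hee', ← hee', disjoint_map] at this
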